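/- For every real p with 0 < p < 1/2, the cardinal characteristic 𝔟(p) equals 𝔟(≠*, h) for the function h(n) = 2^(2^n). -/

import Mathlib

open Filter

namespace Paper

/-! ### Oracle computability -/

/-- Codes for oracle Turing functionals (partial recursive operators with one
function oracle), following the pattern of `Nat.Partrec.Code`. -/
inductive OracleCode : Type
  | zero
  | succ
  | left
  | right
  | oracle
  | pair : OracleCode → OracleCode → OracleCode
  | comp : OracleCode → OracleCode → OracleCode
  | prec : OracleCode → OracleCode → OracleCode
  | rfind' : OracleCode → OracleCode

/-- Evaluation of an oracle code with oracle `g : ℕ → ℕ`. -/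
def OracleCode.eval (g : ℕ → ℕ) : OracleCode → ℕ →. ℕ
  | .zero => pure 0
  | .succ => Nat.succ
  | .left => ↑fun n : ℕ => n.unpair.1
  | .right => ↑fun n : ℕ => n.unpair.2
  | .oracle => ↑fun n : ℕ => g n
  | .pair cf cg => fun n => Nat.pair <$> eval g cf n <*> eval g cg n
  | .comp cf cg => fun n => eval g cg n >>= eval g cf
  | .prec cf cg =>
    Nat.unpaired fun a n =>
      n.rec (eval g cf a) fun y IH => do
        let i ← IH
        eval g cg (Nat.pair a (Nat.pair y i))
  | .rfind' cf =>
    Nat.unpaired fun a m =>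
      (Nat.rfind fun n => (fun m => m = 0) <$> eval g cf (Nat.pair a (n + m))).map (· + m)

/-- Turing reducibility: `f ≤_T g` iff some oracle functional with oracle `g`
computes `f` (totally). -/
def TuringLE (f g : ℕ → ℕ) : Prop :=
  ∃ c : OracleCode, ∀ n, OracleCode.eval g c n = Part.some (f n)

/-- Turing equivalence. -/
def TuringEquiv (f g : ℕ → ℕ) : Prop := TuringLE f g ∧ TuringLE g f

/-- A mass problem is a set of functions `ℕ → ℕ`. -/
abbrev MassProblem := Set (ℕ → ℕ)

/-- Muchnik (weak) reducibility `B ≤_W C`. -/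
def MuchnikLE (B C : MassProblem) : Prop := ∀ g ∈ C, ∃ f ∈ B, TuringLE f g

/-- Muchnik equivalence. -/
def MuchnikEquiv (B C : MassProblem) : Prop := MuchnikLE B C ∧ MuchnikLE C B

/-- Medvedev (strong) reducibility `B ≤_S C`: a single Turing functional is
defined on all of `C` and maps each member of `C` to a member of `B`. -/
def MedvedevLE (B C : MassProblem) : Prop :=
  ∃ c : OracleCode, ∀ g ∈ C, ∃ f ∈ B, ∀ n, OracleCode.eval g c n = Part.some (f n)

/-- Medvedev equivalence. -/
def MedvedevEquiv (B C : MassProblem) : Prop := MedvedevLE B C ∧ MedvedevLE C B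

/-! ### Density notions -/

/-- Lower (asymptotic) density of a set of naturals. -/
noncomputable def lowerDensity (z : Set ℕ) : ℝ :=
  Filter.liminf (fun n => (Nat.card ↥(z ∩ Set.Iio n) : ℝ) / n) Filter.atTop

/-- `x ↔ y`: the agreement set of two functions. -/
def agree (x y : ℕ → ℕ) : Set ℕ := {n | x n = y n}

/-- A bit sequence is a `{0,1}`-valued function. -/
def IsBitSeq (x : ℕ → ℕ) : Prop := ∀ n, x n < 2

/-- The mass problem `D(p)`. -/
def probD (p : ℝ) : MassProblem :=
  {y | IsBitSeq y ∧ ∀ x : ℕ → ℕ, IsBitSeq x → Computable x →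
    lowerDensity (agree x y) ≤ p}

/-- The mass problem `B(p)`. -/
def probB (p : ℝ) : MassProblem :=
  {y | IsBitSeq y ∧ ∀ x : ℕ → ℕ, IsBitSeq x → Computable x →
    p < lowerDensity (agree x y)}

/-- The mass problem `IOE(h)`. -/
def IOE (h : ℕ → ℕ) : MassProblem :=
  {f | ∀ x : ℕ → ℕ, Computable x → (∀ n, x n < h n) → ∃ᶠ n in atTop, f n = x n}

/-- The mass problem `AED(h)`. -/
def AED (h : ℕ → ℕ) : MassProblem :=
  {f | (∀ n, f n < h n) ∧ ∀ x : ℕ → ℕ, Computable x → ∀ᶠ n in atTop, f n ≠ x n}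

/-! ### Hamming distance and the problems `D⟨≠*,ĥ,q⟩`, `B⟨≠*,ĥ,q⟩` -/

/-- Normalized Hamming distance between `a` and `b`, viewed as binary strings
of length `r` (via binary expansion with leading zeros). -/
noncomputable def nhd (r a b : ℕ) : ℝ :=
  (((Finset.range r).filter fun i => a.testBit i ≠ b.testBit i).card : ℝ) / r

/-- The mass problem `D⟨≠*, ĥ, q⟩`. -/
def probDneq (hh : ℕ → ℕ) (q : ℝ) : MassProblem :=
  {y | (∀ n, y n < 2 ^ hh n) ∧ ∀ x : ℕ → ℕ, Computable x → (∀ n, x n < 2 ^ hh n) →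
    ∃ᶠ n in atTop, nhd (hh n) (x n) (y n) < q}

/-- The mass problem `B⟨≠*, ĥ, q⟩`. -/
def probBneq (hh : ℕ → ℕ) (q : ℝ) : MassProblem :=
  {y | (∀ n, y n < 2 ^ hh n) ∧ ∀ x : ℕ → ℕ, Computable x → (∀ n, x n < 2 ^ hh n) →
    ∀ᶠ n in atTop, q ≤ nhd (hh n) (x n) (y n)}

/-! ### Slaloms, coded as functions `ℕ → ℕ` via binary digits -/

/-- `s : ℕ → ℕ`, coding finite sets via binary digits (`i ∈ s(n)` iff the
`i`-th bit of `s n` is set), is an `L`-slalom bounded by `u`. -/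
def IsSlalomCode (u : ℕ → ℕ) (L : ℕ) (s : ℕ → ℕ) : Prop :=
  ∀ n, (∀ i, (s n).testBit i = true → i < u n) ∧
    ((Finset.range (u n)).filter fun i => (s n).testBit i = true).card ≤ L

/-- The mass problem `D⟨∌*, u, L⟩`. -/
def probDSlalom (u : ℕ → ℕ) (L : ℕ) : MassProblem :=
  {s | IsSlalomCode u L s ∧ ∀ y : ℕ → ℕ, Computable y → (∀ n, y n < u n) →
    ∃ᶠ n in atTop, (s n).testBit (y n) = true}

/-- The mass problem `B⟨∌*, u, L⟩`. -/
def probBSlalom (u : ℕ → ℕ) (L : ℕ) : MassProblem :=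
  {y | (∀ n, y n < u n) ∧ ∀ s : ℕ → ℕ, Computable s → IsSlalomCode u L s →
    ∀ᶠ n in atTop, (s n).testBit (y n) = false}

/-! ### Gamma and Delta values -/

/-- `γ(A)`. -/
noncomputable def gammaVal (A : ℕ → ℕ) : ℝ :=
  sSup ((fun x => lowerDensity (agree A x)) '' {x | IsBitSeq x ∧ Computable x})

/-- `Γ(A)`. -/
noncomputable def GammaVal (A : ℕ → ℕ) : ℝ :=
  sInf (gammaVal '' {Y | IsBitSeq Y ∧ TuringEquiv Y A})

/-- `δ(A)`. -/
noncomputable def deltaVal (A : ℕ → ℕ) : ℝ :=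
  sInf ((fun x => lowerDensity (agree A x)) '' {x | IsBitSeq x ∧ Computable x})

/-- `Δ(A)`. -/
noncomputable def DeltaVal (A : ℕ → ℕ) : ℝ :=
  sSup (deltaVal '' {Y | IsBitSeq Y ∧ TuringLE Y A})

/-! ### Cardinal characteristics -/

/-- The cardinal characteristic `𝔡(p)`. -/
noncomputable def dChar (p : ℝ) : Cardinal :=
  sInf {c : Cardinal | ∃ G : Set (ℕ → ℕ), c = Cardinal.mk G ∧ (∀ y ∈ G, IsBitSeq y) ∧
    ∀ x : ℕ → ℕ, IsBitSeq x → ∃ y ∈ G, p < lowerDensity (agree x y)}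

/-- The cardinal characteristic `𝔟(p)`. -/
noncomputable def bChar (p : ℝ) : Cardinal :=
  sInf {c : Cardinal | ∃ F : Set (ℕ → ℕ), c = Cardinal.mk F ∧ (∀ x ∈ F, IsBitSeq x) ∧
    ∀ y : ℕ → ℕ, IsBitSeq y → ∃ x ∈ F, lowerDensity (agree x y) ≤ p}

/-- The cardinal characteristic `𝔡(≠*, h)`. -/
noncomputable def dNeq (h : ℕ → ℕ) : Cardinal :=
  sInf {c : Cardinal | ∃ G : Set (ℕ → ℕ), c = Cardinal.mk G ∧ (∀ y ∈ G, ∀ n, y n < h n) ∧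
    ∀ x : ℕ → ℕ, ∃ y ∈ G, ∀ᶠ n in atTop, x n ≠ y n}

/-- The cardinal characteristic `𝔟(≠*, h)`. -/
noncomputable def bNeq (h : ℕ → ℕ) : Cardinal :=
  sInf {c : Cardinal | ∃ F : Set (ℕ → ℕ), c = Cardinal.mk F ∧
    ∀ y : ℕ → ℕ, (∀ n, y n < h n) → ∃ x ∈ F, ∃ᶠ n in atTop, x n = y n}

/-- The cardinal characteristic `𝔡⟨≠*, ĥ, q⟩`. -/
noncomputable def dHam (hh : ℕ → ℕ) (q : ℝ) : Cardinal :=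
  sInf {c : Cardinal | ∃ G : Set (ℕ → ℕ), c = Cardinal.mk G ∧
    (∀ y ∈ G, ∀ n, y n < 2 ^ hh n) ∧
    ∀ x : ℕ → ℕ, (∀ n, x n < 2 ^ hh n) →
      ∃ y ∈ G, ∀ᶠ n in atTop, q ≤ nhd (hh n) (x n) (y n)}

/-- The cardinal characteristic `𝔟⟨≠*, ĥ, q⟩`. -/
noncomputable def bHam (hh : ℕ → ℕ) (q : ℝ) : Cardinal :=
  sInf {c : Cardinal | ∃ F : Set (ℕ → ℕ), c = Cardinal.mk F ∧
    (∀ x ∈ F, ∀ n, x n < 2 ^ hh n) ∧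
    ∀ y : ℕ → ℕ, (∀ n, y n < 2 ^ hh n) →
      ∃ x ∈ F, ∃ᶠ n in atTop, nhd (hh n) (x n) (y n) < q}

/-- `s : ℕ → Finset ℕ` is an `L`-slalom bounded by `u`. -/
def IsSlalom (u : ℕ → ℕ) (L : ℕ) (s : ℕ → Finset ℕ) : Prop :=
  ∀ n, (∀ i ∈ s n, i < u n) ∧ (s n).card ≤ L

/-- The cardinal characteristic `𝔡⟨∌*, u, L⟩`. -/
noncomputable def dSlalom (u : ℕ → ℕ) (L : ℕ) : Cardinal :=
  sInf {c : Cardinal | ∃ G : Set (ℕ → ℕ), c = Cardinal.mk G ∧ (∀ y ∈ G, ∀ n, y n < u n) ∧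
    ∀ s : ℕ → Finset ℕ, IsSlalom u L s → ∃ y ∈ G, ∀ᶠ n in atTop, y n ∉ s n}

/-- The cardinal characteristic `𝔟⟨∌*, u, L⟩`. -/
noncomputable def bSlalom (u : ℕ → ℕ) (L : ℕ) : Cardinal :=
  sInf {c : Cardinal | ∃ F : Set (ℕ → Finset ℕ), c = Cardinal.mk F ∧
    (∀ s ∈ F, IsSlalom u L s) ∧
    ∀ y : ℕ → ℕ, (∀ n, y n < u n) → ∃ s ∈ F, ∃ᶠ n in atTop, y n ∈ s n}

/-! ### Order functions and list decoding -/

/-- An order function: nondecreasing, unbounded and computable. -/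
def IsOrderFunc (F : ℕ → ℕ) : Prop :=
  Computable F ∧ Monotone F ∧ ∀ b : ℕ, ∃ n, b < F n

/-- The list-decoding property for parameters `q`, `ε`, `L`: for every length `r`
there is a set `C` of `2^⌊εr⌋` binary strings of length `r` (coded as numbers
below `2^r`) such that every string has at most `L` elements of `C` within
normalized Hamming distance `< q`. -/
def ListDecoding (q ε : ℝ) (L : ℕ) : Prop :=
  ∀ r : ℕ, ∃ C : Finset ℕ, (∀ a ∈ C, a < 2 ^ r) ∧ C.card = 2 ^ ⌊ε * r⌋₊ ∧
    ∀ σ < 2 ^ r, (C.filter fun τ => nhd r σ τ < q).card ≤ L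


noncomputable def sg (b : Bool) : ℝ := if b then 1 else -1
noncomputable def corr {N : ℕ} (a b : Fin N → Bool) : ℝ := ∑ i, sg (a i) * sg (b i)

lemma sg_sq (b : Bool) : sg b * sg b = 1 := by cases b <;> simp [sg]

lemma corr_self {N : ℕ} (a : Fin N → Bool) : corr a a = N := by
  simp [corr, sg_sq]

lemma exp_moment {N : ℕ} (c : Fin N → Bool) (t : ℝ) :
    ∑ x : Fin N → Bool, Real.exp (t * corr x c) = (2 * Real.cosh t) ^ N := by
  have h : ∀ x : Fin N → Bool, Real.exp (t * corr x c) =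
      ∏ i, Real.exp (t * (sg (x i) * sg (c i))) := by
    intro x
    rw [corr, Finset.mul_sum, Real.exp_sum]
  simp_rw [h]
  have := Finset.prod_univ_sum (fun _ : Fin N => (Finset.univ : Finset Bool))
    (fun i b => Real.exp (t * (sg b * sg (c i))))
  rw [Fintype.piFinset_univ] at this
  rw [← this]
  have h2 : ∀ i, ∑ b : Bool, Real.exp (t * (sg b * sg (c i))) = 2 * Real.cosh t := by
    intro i
    rw [Real.cosh_eq]
    cases c i <;> simp [sg] <;> ring
  rw [Finset.prod_congr rfl fun i _ => h2 i]
  simp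

lemma ball_card {N : ℕ} (c : Fin N → Bool) (t : ℝ) (ht : 0 ≤ t) :
    ((Finset.univ.filter fun x : Fin N → Bool => t * N ≤ corr x c).card : ℝ)
      * Real.exp (t ^ 2 / 2 * N) ≤ 2 ^ N := by
  have h1 : ((Finset.univ.filter fun x : Fin N → Bool => t * N ≤ corr x c).card : ℝ)
      * Real.exp (t ^ 2 * N) ≤ (2 * Real.cosh t) ^ N := by
    rw [← exp_moment c t, ← nsmul_eq_mul]
    refine (Finset.card_nsmul_le_sum _ (fun x => Real.exp (t * corr x c)) _ ?_).trans
      (Finset.sum_le_sum_of_subset_of_nonneg (Finset.filter_subset _ _)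
        fun _ _ _ => (Real.exp_pos _).le)
    intro x hx
    rw [Finset.mem_filter] at hx
    apply Real.exp_le_exp.2
    nlinarith [mul_le_mul_of_nonneg_left hx.2 ht]
  have h2 : (2 * Real.cosh t) ^ N ≤ 2 ^ N * Real.exp (t ^ 2 / 2 * N) := by
    rw [mul_pow]
    have : Real.exp (t ^ 2 / 2 * N) = Real.exp (t ^ 2 / 2) ^ N := by
      rw [← Real.exp_nat_mul]; ring_nf
    rw [this]
    gcongr
    exact Real.cosh_le_exp_half_sq t
  have h3 : Real.exp (t ^ 2 * N) = Real.exp (t ^ 2 / 2 * N) * Real.exp (t ^ 2 / 2 * N) := by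
    rw [← Real.exp_add]; ring_nf
  rw [h3, ← mul_assoc] at h1
  exact le_of_mul_le_mul_right (h1.trans h2) (Real.exp_pos _)

lemma corr_comm {N : ℕ} (a b : Fin N → Bool) : corr a b = corr b a := by
  simp [corr, mul_comm]

lemma gv (N : ℕ) (t : ℝ) (ht : 0 ≤ t) (ht1 : t ≤ 1) : ∃ C : Finset (Fin N → Bool),
    (∀ a ∈ C, ∀ b ∈ C, a ≠ b → corr a b ≤ t * N) ∧ Real.exp (t ^ 2 / 2 * N) ≤ C.card := by
  classical
  let P : Finset (Fin N → Bool) → Prop :=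
    fun C => ∀ a ∈ C, ∀ b ∈ C, a ≠ b → corr a b ≤ t * N
  obtain ⟨C, hC⟩ := (Set.toFinite {C | P C}).exists_maximal ⟨∅, by simp [P]⟩
  refine ⟨C, hC.1, ?_⟩
  have hcov : (Finset.univ : Finset (Fin N → Bool)) ⊆
      C.biUnion fun c => Finset.univ.filter fun x : Fin N → Bool => t * N ≤ corr x c := by
    intro x _
    rw [Finset.mem_biUnion]
    by_contra! hx
    simp only [Finset.mem_filter, Finset.mem_univ, true_and, not_le] at hx
    have hP : P (insert x C) := by
      intro a ha b hb hab
      rw [Finset.mem_insert] at ha hb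
      rcases ha with rfl | ha <;> rcases hb with rfl | hb
      · exact absurd rfl hab
      · exact (hx b hb).le
      · rw [corr_comm]; exact (hx a ha).le
      · exact hC.1 a ha b hb hab
    have hle := hC.2 hP (Finset.subset_insert x C)
    have := hx x (hle (Finset.mem_insert_self x C))
    rw [corr_self] at this
    nlinarith [(Nat.cast_nonneg N : (0:ℝ) ≤ N)]
  have h1 := (Finset.card_le_card hcov).trans Finset.card_biUnion_le
  have h2 : (2 : ℝ) ^ N ≤ ∑ c ∈ C, ((Finset.univ.filter fun x : Fin N → Bool =>
      t * N ≤ corr x c).card : ℝ) := by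
    simp at h1
    exact_mod_cast h1
  have h3 : (2 : ℝ) ^ N * Real.exp (t ^ 2 / 2 * N) ≤ C.card * 2 ^ N := by
    calc _ ≤ (∑ c ∈ C, ((Finset.univ.filter fun x : Fin N → Bool =>
      t * N ≤ corr x c).card : ℝ)) * Real.exp (t ^ 2 / 2 * N) := by gcongr
      _ = ∑ c ∈ C, ((Finset.univ.filter fun x : Fin N → Bool =>
      t * N ≤ corr x c).card : ℝ) * Real.exp (t ^ 2 / 2 * N) := Finset.sum_mul ..
      _ ≤ ∑ c ∈ C, 2 ^ N := Finset.sum_le_sum fun c _ => ball_card c t ht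
      _ = _ := by simp
  rw [mul_comm] at h3
  exact le_of_mul_le_mul_right h3 (by positivity)

lemma johnson {N : ℕ} (hN : 0 < N) (t g : ℝ) (ht : 0 ≤ t) (hg : 0 ≤ g) (S : Finset (Fin N → Bool))
    (hS : ∀ a ∈ S, ∀ b ∈ S, a ≠ b → corr a b ≤ t * N) (σ : Fin N → Bool)
    (hσ : ∀ a ∈ S, corr σ a ≤ - (g * N)) : S.card * (g ^ 2 - t) ≤ 1 := by
  classical
  have hNr : (0 : ℝ) < N := by exact_mod_cast hN
  set m : ℝ := (S.card : ℝ) with hm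
  have hm0 : 0 ≤ m := by positivity
  let v : Fin N → ℝ := fun i => ∑ a ∈ S, sg (a i)
  have h1 : ∑ i, sg (σ i) * v i = ∑ a ∈ S, corr σ a := by
    simp only [v, corr, Finset.mul_sum]
    exact Finset.sum_comm
  have h2 : ∑ a ∈ S, corr σ a ≤ m * (-(g * N)) := by
    rw [hm, ← nsmul_eq_mul]
    exact Finset.sum_le_card_nsmul _ _ _ hσ
  have h3 : ∑ i, v i ^ 2 = ∑ a ∈ S, ∑ b ∈ S, corr a b := by
    simp only [v, corr, sq, Finset.sum_mul_sum]
    rw [Finset.sum_comm]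
    refine Finset.sum_congr rfl fun a _ => ?_
    exact Finset.sum_comm
  have h4 : ∑ a ∈ S, ∑ b ∈ S, corr a b ≤ m * (N + m * (t * N)) := by
    rw [hm, ← nsmul_eq_mul]
    apply Finset.sum_le_card_nsmul
    intro a ha
    rw [← Finset.add_sum_erase _ _ ha, corr_self]
    gcongr
    refine (Finset.sum_le_card_nsmul _ _ (t * N) ?_).trans ?_
    · intro b hb
      rw [Finset.mem_erase] at hb
      exact hS a ha b hb.2 (Ne.symm hb.1)
    · rw [nsmul_eq_mul]
      gcongr
      exact Finset.erase_subset _ _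
  have h5 := Finset.sum_mul_sq_le_sq_mul_sq Finset.univ (fun i => sg (σ i)) v
  have h6 : ∑ i, sg (σ i) ^ 2 = N := by simp [sq, sg_sq]
  rw [h6, h3, h1] at h5
  have h7 : (m * (g * N)) ^ 2 ≤ (∑ a ∈ S, corr σ a) ^ 2 := by
    have : 0 ≤ m * (g * N) := by positivity
    nlinarith
  have h8 : (m * (g * N)) ^ 2 ≤ N * (m * (N + m * (t * N))) :=
    h7.trans (h5.trans (by gcongr))
  rcases hm0.eq_or_lt with h0 | h0
  · rw [← h0]; simp
  have h9 : (m * N ^ 2) * (m * (g ^ 2 - t)) ≤ (m * N ^ 2) * 1 := by nlinarith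
  exact le_of_mul_le_mul_left h9 (by positivity)

lemma code (q : ℝ) (hq : q < 1 / 2) : ∃ c L : ℕ, ∀ R : ℕ, 0 < R →
    ∃ (E : ℕ → ℕ → ℕ) (D : (ℕ → ℕ) → ℕ → ℕ), (∀ v i, E v i < 2) ∧
      ∀ σ : ℕ → ℕ, (∀ i, σ i < 2) → ∀ v < 2 ^ R,
      (Nat.count (fun i => σ i = E v i) (R * 2 ^ c) : ℝ) ≤ q * (R * 2 ^ c : ℕ) →
      ∃ j < L, D σ j = v := by
  classical
  wlog hq0 : 0 ≤ q generalizing q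
  · obtain ⟨c, L, h⟩ := this 0 (by norm_num) le_rfl
    refine ⟨c, L, fun R hR => ?_⟩
    obtain ⟨E, D, hE, h⟩ := h R hR
    refine ⟨E, D, hE, fun σ hσ v hv hc => h σ hσ v hv (hc.trans ?_)⟩
    gcongr
    exact (not_le.1 hq0).le
  set g : ℝ := 1 - 2 * q with hgdef
  have hg : 0 < g := by linarith
  set t : ℝ := g ^ 2 / 2 with htdef
  have ht : 0 < t := by positivity
  have ht1 : t ≤ 1 := by
    have : g ≤ 1 := by linarith
    nlinarith
  obtain ⟨c, hc⟩ := pow_unbounded_of_one_lt (2 / t ^ 2) (one_lt_two : (1:ℝ) < 2)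
  obtain ⟨L, hL⟩ := exists_nat_gt (1 / t)
  refine ⟨c, L, fun R hR => ?_⟩
  set N := R * 2 ^ c with hN
  have hNpos : 0 < N := by positivity
  obtain ⟨C, hC, hcard⟩ := gv N t ht.le ht1
  have hbig : 2 ^ R ≤ C.card := by
    have : (2 : ℝ) ^ R ≤ Real.exp (t ^ 2 / 2 * N) := by
      have e1 : (2 : ℝ) ^ R ≤ Real.exp 1 ^ R := by
        gcongr
        linarith [Real.add_one_le_exp 1]
      refine e1.trans ?_
      rw [← Real.exp_nat_mul]
      apply Real.exp_le_exp.2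
      rw [hN]; push_cast
      have : 1 ≤ t ^ 2 / 2 * 2 ^ c := by
        rw [div_lt_iff₀ (by positivity)] at hc
        linarith
      nlinarith [(Nat.cast_nonneg R : (0:ℝ) ≤ R)]
    exact_mod_cast this.trans hcard
  let e : ℕ → (Fin N → Bool) := fun v => if h : v < C.card then (C.equivFin.symm ⟨v, h⟩).1
    else fun _ => false
  have he : ∀ v < C.card, e v ∈ C := by
    intro v hv
    simp only [e, hv, dif_pos]
    exact (C.equivFin.symm ⟨v, hv⟩).2
  have hinj : ∀ v < C.card, ∀ w < C.card, e v = e w → v = w := by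
    intro v hv w hw h
    simp only [e, hv, hw, dif_pos] at h
    have := C.equivFin.symm.injective (Subtype.ext h)
    simpa using this
  let E : ℕ → ℕ → ℕ := fun v i => if h : i < N then (e v ⟨i, h⟩).toNat else 0
  let tb : (ℕ → ℕ) → Fin N → Bool := fun σ i => decide (σ i = 1)
  let lst : (ℕ → ℕ) → Finset ℕ := fun σ =>
    (Finset.range (2 ^ R)).filter fun v => corr (tb σ) (e v) ≤ -(g * N)
  have hlst : ∀ σ, (lst σ).card ≤ L := by
    intro σ
    have hi : ((lst σ).image e).card = (lst σ).card := by
      apply Finset.card_image_of_injOn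
      intro v hv w hw h
      simp only [lst, Finset.coe_filter, Finset.mem_range, Set.mem_ofPred_eq] at hv hw
      exact hinj v (hv.1.trans_le hbig) w (hw.1.trans_le hbig) h
    have hj := johnson hNpos t g ht.le hg.le ((lst σ).image e) (by
      intro a ha b hb
      obtain ⟨v, hv, rfl⟩ := Finset.mem_image.1 ha
      obtain ⟨w, hw, rfl⟩ := Finset.mem_image.1 hb
      simp only [lst, Finset.mem_filter, Finset.mem_range] at hv hw
      exact hC _ (he v (hv.1.trans_le hbig)) _ (he w (hw.1.trans_le hbig))) (tb σ) (by
      intro a ha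
      obtain ⟨v, hv, rfl⟩ := Finset.mem_image.1 ha
      simp only [lst, Finset.mem_filter, Finset.mem_range] at hv
      exact hv.2)
    rw [hi] at hj
    have e2 : g ^ 2 - t = t := by rw [htdef]; ring
    rw [e2, ← le_div_iff₀ ht] at hj
    exact_mod_cast (hj.trans_lt hL).le
  refine ⟨E, fun σ j => (lst σ).toList.getD j 0, ?_, ?_⟩
  · intro v i
    simp only [E]
    split_ifs with h
    · exact Bool.toNat_lt _
    · norm_num
  intro σ hσ v hv hcount
  have hmem : v ∈ lst σ := by
    simp only [lst, Finset.mem_filter, Finset.mem_range]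
    refine ⟨hv, ?_⟩
    have hcorr : corr (tb σ) (e v) = 2 * (Nat.count (fun i => σ i = E v i) N : ℝ) - N := by
      rw [Nat.count_eq_card_filter_range, Finset.card_filter, Finset.sum_range]
      push_cast
      have : ∀ i : Fin N, sg (tb σ i) * sg (e v i) =
          2 * (if σ i = E v i then (1:ℝ) else 0) - 1 := by
        intro i
        have h2 := hσ i
        simp only [E, i.2, dif_pos, Fin.eta, tb]
        generalize e v i = b
        interval_cases σ i <;> cases b <;> simp [sg] <;> norm_num
      simp only [corr, this]
      rw [Finset.sum_sub_distrib, Finset.mul_sum]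
      simp
    rw [hcorr, hgdef]
    linarith
  obtain ⟨j, hj, hjv⟩ := List.mem_iff_getElem.1 (Finset.mem_toList.2 hmem)
  refine ⟨j, ?_, ?_⟩
  · rw [Finset.length_toList] at hj
    exact hj.trans_le (hlst σ)
  · simp [List.getD_eq_getElem?_getD, List.getElem?_eq_getElem hj, hjv]

lemma card_agree (x y : ℕ → ℕ) (n : ℕ) :
    Nat.card ↥(agree x y ∩ Set.Iio n) = Nat.count (fun i => x i = y i) n := by
  rw [Nat.count_eq_card_filter_range, Nat.card_coe_set_eq, ← Set.ncard_coe_finset]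
  congr 1
  ext i
  simp [agree, and_comm]

lemma ratio_nonneg (x y : ℕ → ℕ) (n : ℕ) :
    (0 : ℝ) ≤ (Nat.card ↥(agree x y ∩ Set.Iio n) : ℝ) / n := by positivity

lemma ratio_le_one (x y : ℕ → ℕ) (n : ℕ) :
    (Nat.card ↥(agree x y ∩ Set.Iio n) : ℝ) / n ≤ 1 := by
  rw [card_agree]
  apply div_le_one_of_le₀ _ (by positivity)
  exact_mod_cast Nat.count_le _

lemma density_le {x y : ℕ → ℕ} {p : ℝ}
    (h : ∃ᶠ n in atTop, (Nat.count (fun i => x i = y i) n : ℝ) ≤ p * n) (hp : 0 ≤ p) :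
    lowerDensity (agree x y) ≤ p := by
  apply liminf_le_of_frequently_le
  · refine h.mono fun n hn => ?_
    rw [card_agree]
    exact div_le_of_le_mul₀ (by positivity) hp hn
  · exact isBoundedUnder_of ⟨0, fun n => ratio_nonneg x y n⟩

lemma le_density {x y : ℕ → ℕ} {p : ℝ}
    (h : ∀ᶠ n in atTop, p * n ≤ (Nat.count (fun i => x i = y i) n : ℝ)) :
    p ≤ lowerDensity (agree x y) := by
  apply le_liminf_of_le
  · exact (isBoundedUnder_of ⟨1, fun n => ratio_le_one x y n⟩).isCoboundedUnder_ge
  · filter_upwards [h, eventually_gt_atTop 0] with n hn hn0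
    rw [card_agree]
    rw [le_div_iff₀ (by exact_mod_cast hn0)]
    exact hn

/-- The transformed family. -/
def fam (F : Set (ℕ → ℕ)) {ι : Type} (T : (ℕ → ℕ) → ι → (ℕ → ℕ)) : Set (ℕ → ℕ) :=
  Set.image (fun z : (ℕ → ℕ) × ι => T z.1 z.2) (F ×ˢ Set.univ)

lemma fam_finite {F : Set (ℕ → ℕ)} {ι : Type} [Finite ι] (T : (ℕ → ℕ) → ι → (ℕ → ℕ))
    (hF : F.Finite) : (fam F T).Finite :=
  (hF.prod Set.finite_univ).image _

lemma fam_card {F : Set (ℕ → ℕ)} {ι : Type} [Finite ι] (T : (ℕ → ℕ) → ι → (ℕ → ℕ))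
    (hF : F.Infinite) : Cardinal.mk (fam F T) ≤ Cardinal.mk F := by
  have : Infinite F := hF.to_subtype
  refine Cardinal.mk_image_le.trans ?_
  rw [Cardinal.mk_congr (Equiv.Set.prod F (Set.univ : Set ι)), Cardinal.mk_prod]
  simp only [Cardinal.lift_id]
  refine Cardinal.mul_le_of_le (Cardinal.aleph0_le_mk F) le_rfl ?_
  exact (Cardinal.mk_le_aleph0 (α := (Set.univ : Set ι))).trans (Cardinal.aleph0_le_mk F)

/-- Witness for `bNeq`. -/
def WN (F : Set (ℕ → ℕ)) : Prop :=
  ∀ y : ℕ → ℕ, (∀ n, y n < 2 ^ 2 ^ n) → ∃ x ∈ F, ∃ᶠ n in atTop, x n = y n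

/-- Witness for `bChar`. -/
def WC (p : ℝ) (F : Set (ℕ → ℕ)) : Prop :=
  (∀ x ∈ F, IsBitSeq x) ∧ ∀ y : ℕ → ℕ, IsBitSeq y → ∃ x ∈ F, lowerDensity (agree x y) ≤ p

lemma WN_infinite {F : Set (ℕ → ℕ)} (h : WN F) : F.Infinite := by
  classical
  intro hfin
  lift F to Finset (ℕ → ℕ) using hfin
  have hex : ∀ n, ∃ v, v < 2 ^ 2 ^ n ∧ (F.card < 2 ^ 2 ^ n → ∀ x ∈ F, x n ≠ v) := by
    intro n
    by_cases hc : F.card < 2 ^ 2 ^ n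
    · have : (F.image fun x => x n).card < (Finset.range (2 ^ 2 ^ n)).card := by
        rw [Finset.card_range]
        exact Finset.card_image_le.trans_lt hc
      obtain ⟨v, hv, hv2⟩ := Finset.exists_mem_notMem_of_card_lt_card this
      refine ⟨v, Finset.mem_range.1 hv, fun _ x hx hxv => hv2 ?_⟩
      exact Finset.mem_image.2 ⟨x, hx, hxv⟩
    · exact ⟨0, by positivity, fun h => absurd h hc⟩
  choose y hy hy2 using hex
  obtain ⟨x, hx, hf⟩ := h y hy
  have hev : ∀ᶠ n in atTop, x n ≠ y n := by
    filter_upwards [eventually_ge_atTop F.card] with n hn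
    refine hy2 n ?_ x hx
    exact hn.trans_lt (Nat.lt_two_pow_self.trans Nat.lt_two_pow_self)
  exact hf (hev.mono fun n hn => hn)

/-- Complemented guess. -/
def guess (k : ℕ) (x : ℕ → ℕ) (i : Fin k) (j : ℕ) : ℕ :=
  1 - ((x (i + k * ((Nat.log 2 j - i) / k + 1))).testBit j).toNat

/-- Code of an initial segment. -/
lemma exists_code (y : ℕ → ℕ) (hy : IsBitSeq y) (n : ℕ) :
    ∃ v < 2 ^ n, ∀ i < n, (v.testBit i).toNat = y i := by
  refine ⟨Nat.ofBits (fun i : Fin n => decide (y i = 1)), Nat.ofBits_lt_two_pow _, ?_⟩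
  intro i hi
  rw [Nat.testBit_ofBits_lt _ _ hi]
  have := hy i
  interval_cases y i <;> simp

lemma dir1 {p : ℝ} (hp : 0 < p) {F : Set (ℕ → ℕ)} (h : WN F) :
    ∃ F', WC p F' ∧ Cardinal.mk F' ≤ Cardinal.mk F := by
  classical
  obtain ⟨k, hk⟩ := pow_unbounded_of_one_lt (1 / p) (one_lt_two : (1:ℝ) < 2)
  obtain ⟨k, rfl, hk⟩ : ∃ k', k' = k + 1 ∧ 1 / p < 2 ^ k' := by
    refine ⟨k + 1, rfl, hk.trans_le ?_⟩
    exact pow_le_pow_right₀ (by norm_num) (by omega)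
  set K := k + 1 with hK
  have hKpos : 0 < K := by omega
  refine ⟨fam F (guess K), ⟨?_, ?_⟩, fam_card _ (WN_infinite h)⟩
  · rintro _ ⟨⟨x, i⟩, -, rfl⟩ j
    simp only [guess]
    omega
  intro y hy
  choose c hc hc2 using fun n => exists_code y hy (2 ^ n)
  obtain ⟨x, hx, hf⟩ := h c hc
  have hres : ∃ i : Fin K, ∃ᶠ m in atTop, x m = c m ∧ m % K = i := by
    by_contra hcon
    push Not at hcon
    have := eventually_all.2 hcon
    refine hf (this.mono fun m hm he => ?_)
    exact hm ⟨m % K, Nat.mod_lt _ hKpos⟩ he rfl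
  obtain ⟨i, hi⟩ := hres
  refine ⟨guess K x i, ⟨(x, i), ⟨hx, trivial⟩, rfl⟩, density_le ?_ hp.le⟩
  rw [frequently_atTop] at hi ⊢
  intro a
  obtain ⟨m, hm, hxm, hmi⟩ := hi (a + K)
  refine ⟨2 ^ m, ?_, ?_⟩
  · exact (Nat.lt_two_pow_self (n := m)).le.trans' (by omega)
  have hzero : ∀ j, 2 ^ (m - K) ≤ j → j < 2 ^ m → guess K x i j ≠ y j := by
    intro j hj1 hj2
    have hj0 : j ≠ 0 := by
      have : 0 < 2 ^ (m - K) := by positivity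
      omega
    have hl1 : m - K ≤ Nat.log 2 j := (Nat.le_log_iff_pow_le (by norm_num) hj0).2 hj1
    have hl2 : Nat.log 2 j < m := (Nat.log_lt_iff_lt_pow (by norm_num) hj0).2 hj2
    have hidx : (i : ℕ) + K * ((Nat.log 2 j - i) / K + 1) = m := by
      have hdm := Nat.div_add_mod m K
      rw [hmi] at hdm
      have hmK : 0 < m / K := Nat.div_pos (by omega) hKpos
      obtain ⟨b, hb⟩ : ∃ b, m / K = b + 1 := ⟨m / K - 1, by omega⟩
      rw [hb] at hdm
      have : (Nat.log 2 j - i) / K = b := by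
        rw [Nat.div_eq_iff hKpos]
        have e1 : K * (b + 1) = b * K + K := by ring
        omega
      rw [this]
      omega
    simp only [guess, hidx, hxm, hc2 m j hj2]
    have := hy j
    omega
  have hcount : Nat.count (fun j => guess K x i j = y j) (2 ^ m) ≤ 2 ^ (m - K) := by
    have hle : 2 ^ (m - K) ≤ 2 ^ m := Nat.pow_le_pow_right (by norm_num) (by omega)
    obtain ⟨e, he⟩ := Nat.exists_eq_add_of_le hle
    rw [he, Nat.count_add]
    have : Nat.count (fun j => guess K x i (2 ^ (m - K) + j) = y (2 ^ (m - K) + j)) e = 0 := by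
      rw [Nat.count_eq_card_filter_range, Finset.card_eq_zero, Finset.filter_eq_empty_iff]
      intro j hj
      rw [Finset.mem_range] at hj
      exact hzero _ (by omega) (by omega)
    rw [this]
    exact Nat.count_le _
  have hpow : (2 : ℝ) ^ m = 2 ^ (m - K) * 2 ^ K := by
    rw [← pow_add]; congr 1; omega
  have h1 : 1 ≤ p * 2 ^ K := by
    rw [div_lt_iff₀ hp] at hk
    linarith
  calc (Nat.count (fun j => guess K x i j = y j) (2 ^ m) : ℝ) ≤ 2 ^ (m - K) := by exact_mod_cast hcount
    _ ≤ p * ((2 ^ m : ℕ) : ℝ) := by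
      push_cast
      rw [hpow]
      nlinarith [pow_pos (two_pos : (0:ℝ) < 2) (m - K)]

lemma dir2 {p : ℝ} (hp0 : 0 < p) (hp1 : p < 1 / 2) {F : Set (ℕ → ℕ)} (h : WC p F) :
    ∃ F', WN F' ∧ Cardinal.mk F' ≤ Cardinal.mk F := by
  classical
  obtain ⟨q, hpq, hq⟩ := exists_between hp1
  have hq0 : 0 < q := hp0.trans hpq
  obtain ⟨p', hpp', hp'q⟩ := exists_between hpq
  obtain ⟨c, L, hcode⟩ := code q hq
  obtain ⟨d, hd⟩ := pow_unbounded_of_one_lt (q / (q - p')) (one_lt_two : (1:ℝ) < 2)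
  choose E D hE hD using fun n : ℕ => hcode (2 ^ n) (by positivity)
  let T : (ℕ → ℕ) → Fin (2 ^ d) × Fin L → ℕ → ℕ := fun x bj n =>
    D n (fun i => x (2 ^ (n + c + d) + bj.1 * 2 ^ (n + c) + i)) bj.2
  have key : WN (fam F T) := by
    intro y hy
    let Y : ℕ → ℕ := fun s =>
      E (Nat.log 2 s - (c + d)) (y (Nat.log 2 s - (c + d)))
        ((s - 2 ^ Nat.log 2 s) % 2 ^ (Nat.log 2 s - (c + d) + c))
    have hY : IsBitSeq Y := fun s => hE _ _ _
    have hYval : ∀ n b i, b < 2 ^ d → i < 2 ^ (n + c) →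
        Y (2 ^ (n + c + d) + b * 2 ^ (n + c) + i) = E n (y n) i := by
      intro n b i hb hi
      have hlt : b * 2 ^ (n + c) + i < 2 ^ (n + c + d) := by
        have : (b + 1) * 2 ^ (n + c) ≤ 2 ^ d * 2 ^ (n + c) := Nat.mul_le_mul_right _ hb
        rw [pow_add 2 (n + c) d]
        nlinarith
      have hlog : Nat.log 2 (2 ^ (n + c + d) + b * 2 ^ (n + c) + i) = n + c + d := by
        apply Nat.log_eq_of_pow_le_of_lt_pow
        · omega
        · rw [pow_succ 2 (n + c + d)]; omega
      have hn : n + c + d - (c + d) = n := by omega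
      simp only [Y, hlog, hn]
      congr 1
      have : 2 ^ (n + c + d) + b * 2 ^ (n + c) + i - 2 ^ (n + c + d) = i + b * 2 ^ (n + c) := by omega
      rw [this, Nat.add_mul_mod_self_right, Nat.mod_eq_of_lt hi]
    obtain ⟨x, hx, hden⟩ := h.2 Y hY
    have hxb := h.1 x hx
    by_contra hcon
    push Not at hcon
    have hcon2 : ∀ bj : Fin (2 ^ d) × Fin L, ∀ᶠ n in atTop, T x bj n ≠ y n := by
      intro bj
      exact hcon (T x bj) ⟨(x, bj), ⟨hx, trivial⟩, rfl⟩
    obtain ⟨n0, hn0⟩ := eventually_atTop.1 (eventually_all.2 hcon2)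
    let A : ℕ → ℕ := fun N => Nat.count (fun i => x i = Y i) N
    have hAmono : Monotone A := Nat.count_monotone _
    have hblock : ∀ n ≥ n0, ∀ b < 2 ^ d,
        (A (2 ^ (n + c + d) + b * 2 ^ (n + c)) : ℝ) + q * 2 ^ (n + c) ≤
          A (2 ^ (n + c + d) + (b + 1) * 2 ^ (n + c)) := by
      intro n hn b hb
      have e1 : 2 ^ (n + c + d) + (b + 1) * 2 ^ (n + c) =
        2 ^ (n + c + d) + b * 2 ^ (n + c) + 2 ^ (n + c) := by ring
      rw [e1]
      simp only [A]
      rw [Nat.count_add _ (2 ^ (n + c + d) + b * 2 ^ (n + c)) (2 ^ (n + c))]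
      push_cast
      refine add_le_add le_rfl ?_
      by_contra! hlt
      have e2 : Nat.count (fun i => x (2 ^ (n + c + d) + b * 2 ^ (n + c) + i) =
          Y (2 ^ (n + c + d) + b * 2 ^ (n + c) + i)) (2 ^ (n + c)) =
          Nat.count (fun i => x (2 ^ (n + c + d) + b * 2 ^ (n + c) + i) = E n (y n) i)
            (2 ^ n * 2 ^ c) := by
        rw [← pow_add, Nat.count_eq_card_filter_range, Nat.count_eq_card_filter_range]
        congr 1
        apply Finset.filter_congr
        intro i hi
        rw [hYval n b i hb (Finset.mem_range.1 hi)]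
      rw [e2] at hlt
      obtain ⟨j, hj, hjv⟩ := hD n (fun i => x (2 ^ (n + c + d) + b * 2 ^ (n + c) + i))
        (fun i => hxb _) (y n) (hy n) (by
          refine hlt.le.trans (le_of_eq ?_)
          push_cast
          rw [← pow_add])
      exact hn0 n hn (⟨b, hb⟩, ⟨j, hj⟩) hjv
    -- lower bound at block ends
    have hrow : ∀ n ≥ n0, ∀ b ≤ 2 ^ d,
        (A (2 ^ (n + c + d)) : ℝ) + q * (b * 2 ^ (n + c)) ≤
          A (2 ^ (n + c + d) + b * 2 ^ (n + c)) := by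
      intro n hn b
      induction b with
      | zero => intro _; simp
      | succ b ih =>
        intro hb
        have h1 := ih (by omega)
        have h2 := hblock n hn b (by omega)
        push_cast at h1 h2 ⊢
        linarith
    have hcol : ∀ r, q * (2 ^ (n0 + r + c + d) - 2 ^ (n0 + c + d)) ≤
        (A (2 ^ (n0 + r + c + d)) : ℝ) := by
      intro r
      induction r with
      | zero => simp
      | succ r ih =>
        have h1 := hrow (n0 + r) (by omega) (2 ^ d) le_rfl
        have e1 : 2 ^ (n0 + r + c + d) + 2 ^ d * 2 ^ (n0 + r + c) = 2 ^ (n0 + (r + 1) + c + d) := by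
          ring
        rw [e1] at h1
        push_cast at h1
        have e2 : (2:ℝ) ^ (n0 + (r + 1) + c + d) =
          2 ^ (n0 + r + c + d) + 2 ^ d * 2 ^ (n0 + r + c) := by ring
        rw [e2]
        linarith
    have hall : ∀ N, 2 ^ (n0 + c + d) ≤ N →
        q * (N - N / 2 ^ d - 2 ^ (n0 + c + d)) ≤ (A N : ℝ) := by
      intro N hN
      have hN0 : N ≠ 0 := by
        have : 0 < 2 ^ (n0 + c + d) := by positivity
        omega
      have hl : n0 + c + d ≤ Nat.log 2 N := (Nat.le_log_iff_pow_le (by norm_num) hN0).2 hN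
      obtain ⟨r, hr⟩ : ∃ r, Nat.log 2 N = n0 + r + c + d := ⟨Nat.log 2 N - (n0 + c + d), by omega⟩
      have hlo : 2 ^ (n0 + r + c + d) ≤ N := hr ▸ Nat.pow_log_le_self 2 hN0
      have hhi : N < 2 ^ (n0 + r + c + d + 1) := hr ▸ Nat.lt_pow_succ_log_self (by norm_num) N
      set B := 2 ^ (n0 + r + c) with hB
      have hBd : 2 ^ (n0 + r + c + d) = 2 ^ d * B := by rw [hB]; ring
      have hBpos : 0 < B := by positivity
      set b := (N - 2 ^ (n0 + r + c + d)) / B with hb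
      have hdm := Nat.div_add_mod (N - 2 ^ (n0 + r + c + d)) B
      have hmod := Nat.mod_lt (N - 2 ^ (n0 + r + c + d)) hBpos
      rw [← hb] at hdm
      have hb2 : b ≤ 2 ^ d := by
        apply Nat.div_le_of_le_mul
        rw [pow_succ] at hhi
        rw [mul_comm, ← hBd]
        omega
      have h1 := hrow (n0 + r) (by omega) b hb2
      have h2 := hcol r
      have h3 : A (2 ^ (n0 + r + c + d) + b * B) ≤ A N := hAmono (by
        rw [mul_comm b B]; omega)
      have h3' : (A (2 ^ (n0 + r + c + d) + b * B) : ℝ) ≤ A N := by exact_mod_cast h3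
      have h4 : N ≤ 2 ^ (n0 + r + c + d) + b * B + B := by
        rw [mul_comm b B]; omega
      have h4' : (N : ℝ) ≤ 2 ^ (n0 + r + c + d) + b * B + B := by exact_mod_cast h4
      have h5 : (B : ℝ) ≤ N / 2 ^ d := by
        rw [le_div_iff₀ (by positivity)]
        rw [hBd, mul_comm] at hlo
        exact_mod_cast hlo
      have h6 : (B : ℝ) = 2 ^ (n0 + r + c) := by rw [hB]; push_cast; rfl
      rw [← h6] at h1
      have h7 : q * (N - N / 2 ^ d - 2 ^ (n0 + c + d)) ≤
          q * (2 ^ (n0 + r + c + d) - 2 ^ (n0 + c + d) + b * B) := by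
        gcongr
        linarith
      linarith
    have hfin : p' ≤ lowerDensity (agree x Y) := by
      apply le_density
      have hpos : 0 < q - p' - q / 2 ^ d := by
        rw [div_lt_iff₀ (by linarith)] at hd
        have : q / 2 ^ d < q - p' := by
          rw [div_lt_iff₀ (by positivity)]
          linarith
        linarith
      have htend := (tendsto_natCast_atTop_atTop (R := ℝ)).const_mul_atTop hpos
      filter_upwards [eventually_ge_atTop (2 ^ (n0 + c + d)),
        htend.eventually_ge_atTop (q * 2 ^ (n0 + c + d))] with N h1 h2
      refine le_trans ?_ (hall N h1)
      have : q * (N - N / 2 ^ d - 2 ^ (n0 + c + d)) =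
        (q - p' - q / 2 ^ d) * N + p' * N - q * 2 ^ (n0 + c + d) := by ring
      rw [this]
      linarith
    linarith
  refine ⟨fam F T, key, fam_card T fun hfin => WN_infinite key (fam_finite T hfin)⟩

/-- For every real `p` with `0 < p < 1/2`, `𝔟(p) = 𝔟(≠*, n ↦ 2^(2^n))`. -/
theorem stmt5 (p : ℝ) (hp0 : 0 < p) (hp1 : p < 1 / 2) :
    bChar p = bNeq fun n => 2 ^ 2 ^ n := by
  have hN : {c : Cardinal | ∃ F : Set (ℕ → ℕ), c = Cardinal.mk F ∧ WN F}.Nonempty :=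
    ⟨_, Set.univ, rfl, fun y _ => ⟨y, trivial, Frequently.of_forall fun _ => rfl⟩⟩
  have hC : {c : Cardinal | ∃ F : Set (ℕ → ℕ), c = Cardinal.mk F ∧ WC p F}.Nonempty := by
    obtain ⟨_, F, -, hF⟩ := hN
    obtain ⟨F', hF', -⟩ := dir1 hp0 hF
    exact ⟨_, F', rfl, hF'⟩
  apply le_antisymm
  · refine le_csInf hN ?_
    rintro _ ⟨F, rfl, hF⟩
    obtain ⟨F', hF', hle⟩ := dir1 hp0 hF
    refine le_trans ?_ hle
    exact csInf_le' ⟨F', rfl, hF'⟩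
  · refine le_csInf hC ?_
    rintro _ ⟨F, rfl, hF⟩
    obtain ⟨F', hF', hle⟩ := dir2 hp0 hp1 hF
    refine le_trans ?_ hle
    exact csInf_le' ⟨F', rfl, hF'⟩

end Paper
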